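/- For every natural number n and real x, the n-th (probabilists') Hermite polynomial satisfies h_n(x) = E[(x + iZ)^n], where Z is a standard normal random variable and i is the imaginary unit; equivalently, h_n(x) equals the real part of the expectation of (x + iZ)^n and the imaginary part vanishes. -/

import Mathlib

open MeasureTheory ProbabilityTheory Polynomial Complex

namespace ProbabilityTheory

lemma hasDerivAt_gaussianPDFReal_standard (z : ℝ) :
    HasDerivAt (gaussianPDFReal 0 1) (-z * gaussianPDFReal 0 1 z) z := by
  have h : HasDerivAt (fun z : ℝ ↦ -(z - 0) ^ 2 / (2 * ((1 : NNReal) : ℝ))) (-z) z := by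
    refine ((((hasDerivAt_id z).sub_const 0).pow 2).neg.div_const _).congr_deriv ?_
    simp [neg_div]
  refine (h.exp.const_mul (√(2 * Real.pi * ((1 : NNReal) : ℝ)))⁻¹).congr_deriv ?_
  rw [gaussianPDFReal_def]
  ring

lemma integrable_gaussianReal_iff_integrable_smul {E : Type*} [NormedAddCommGroup E]
    [NormedSpace ℝ E] {μ : ℝ} {v : NNReal} (hv : v ≠ 0) {f : ℝ → E} :
    Integrable f (gaussianReal μ v) ↔ Integrable (fun z ↦ gaussianPDFReal μ v z • f z) := by
  rw [gaussianReal_of_var_ne_zero μ hv, integrable_withDensity_iff_integrable_smul'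
    (measurable_gaussianPDF μ v) (ae_of_all _ fun _ ↦ gaussianPDF_lt_top)]
  simp only [toReal_gaussianPDF]

/-- Gaussian integration by parts (Stein's identity). -/
lemma integral_smul_gaussianReal_eq_integral_deriv {E : Type*} [NormedAddCommGroup E]
    [NormedSpace ℝ E] {f f' : ℝ → E}
    (hderiv : ∀ z, HasDerivAt f (f' z) z) (hf : Integrable f (gaussianReal 0 1))
    (hf' : Integrable f' (gaussianReal 0 1))
    (hzf : Integrable (fun z ↦ z • f z) (gaussianReal 0 1)) :
    ∫ z, z • f z ∂gaussianReal 0 1 = ∫ z, f' z ∂gaussianReal 0 1 := by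
  have hd (z : ℝ) : HasDerivAt (fun z ↦ gaussianPDFReal 0 1 z • f z)
      (gaussianPDFReal 0 1 z • (f' z - z • f z)) z := by
    refine ((hasDerivAt_gaussianPDFReal_standard z).smul (hderiv z)).congr_deriv ?_
    module
  have h := integral_eq_zero_of_hasDerivAt_of_integrable hd
    ((integrable_gaussianReal_iff_integrable_smul one_ne_zero).1 (hf'.sub hzf))
    ((integrable_gaussianReal_iff_integrable_smul one_ne_zero).1 hf)
  rw [← integral_gaussianReal_eq_integral_smul one_ne_zero, integral_sub hf' hzf] at h
  exact (sub_eq_zero.1 h).symm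

lemma integrable_add_I_mul_pow_gaussianReal (μ : ℝ) (v : NNReal) (w : ℂ) (n : ℕ) :
    Integrable (fun z : ℝ ↦ (w + I * (z : ℂ)) ^ n) (gaussianReal μ v) := by
  have h : MemLp (fun z : ℝ ↦ w + I * (z : ℂ)) n (gaussianReal μ v) := by
    refine (memLp_const w).add (MemLp.const_mul ?_ I)
    exact (memLp_id_gaussianReal' n (by simp)).ofReal
  refine (integrable_norm_iff (by fun_prop)).1 ?_
  simpa only [norm_pow] using h.integrable_norm_pow'

lemma integral_add_I_mul_pow_gaussianReal_add_two (w : ℂ) (n : ℕ) :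
    ∫ z : ℝ, (w + I * (z : ℂ)) ^ (n + 2) ∂gaussianReal 0 1 =
      w * ∫ z : ℝ, (w + I * (z : ℂ)) ^ (n + 1) ∂gaussianReal 0 1
        - (n + 1) * ∫ z : ℝ, (w + I * (z : ℂ)) ^ n ∂gaussianReal 0 1 := by
  have hint (k : ℕ) := integrable_add_I_mul_pow_gaussianReal 0 1 w k
  have hsmul (z : ℝ) : z • (w + I * (z : ℂ)) ^ (n + 1) =
      I * (w * (w + I * (z : ℂ)) ^ (n + 1) - (w + I * (z : ℂ)) ^ (n + 2)) := by
    rw [real_smul]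
    linear_combination (z : ℂ) * (w + I * z) ^ (n + 1) * I_sq
  have hzf : Integrable (fun z : ℝ ↦ z • (w + I * (z : ℂ)) ^ (n + 1)) (gaussianReal 0 1) := by
    simp only [hsmul]
    exact (((hint _).const_mul _).sub (hint _)).const_mul _
  have hderiv (z : ℝ) : HasDerivAt (fun z : ℝ ↦ (w + I * (z : ℂ)) ^ (n + 1))
      ((n + 1) * I * (w + I * (z : ℂ)) ^ n) z := by
    have h : HasDerivAt (fun z : ℝ ↦ w + I * (z : ℂ)) I z := by
      simpa using (((hasDerivAt_id z).ofReal_comp).const_mul I).const_add w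
    refine (h.pow (n + 1)).congr_deriv ?_
    push_cast
    ring
  have h := integral_smul_gaussianReal_eq_integral_deriv hderiv (hint _)
    ((hint n).const_mul _) hzf
  simp only [hsmul] at h
  rw [integral_const_mul, integral_sub ((hint _).const_mul _) (hint _), integral_const_mul,
    integral_const_mul] at h
  refine mul_left_cancel₀ I_ne_zero ?_
  linear_combination -h

end ProbabilityTheory

namespace Polynomial

lemma derivative_hermite_succ (n : ℕ) :
    derivative (hermite (n + 1)) = (n + 1 : ℤ[X]) * hermite n := by
  induction n with
  | zero => simp
  | succ n ih =>
    rw [hermite_succ (n + 1), derivative_sub, derivative_mul, ih, derivative_mul, hermite_succ n]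
    simp
    ring

lemma hermite_add_two (n : ℕ) :
    hermite (n + 2) = X * hermite (n + 1) - (n + 1 : ℤ[X]) * hermite n := by
  rw [hermite_succ, derivative_hermite_succ]

end Polynomial

lemma integral_add_I_mul_pow_gaussianReal_eq_aeval_hermite (w : ℂ) (n : ℕ) :
    ∫ z : ℝ, (w + I * (z : ℂ)) ^ n ∂gaussianReal 0 1 = aeval w (hermite n) := by
  induction n using Nat.twoStepInduction with
  | zero => simp
  | one =>
    have hz : Integrable (fun z : ℝ ↦ (z : ℂ)) (gaussianReal 0 1) := by
      simpa using
        ((memLp_id_gaussianReal' (μ := 0) (v := 1) 1 (by simp)).integrable le_rfl).ofReal (𝕜 := ℂ)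
    simp only [pow_one, hermite_one, aeval_X]
    rw [integral_add (integrable_const w) (hz.const_mul I), integral_const_mul,
      integral_complex_ofReal, integral_id_gaussianReal]
    simp
  | more n ih ih' =>
    rw [integral_add_I_mul_pow_gaussianReal_add_two, ih, ih', hermite_add_two]
    simp

/-- For every `n : ℕ` and real `x`, the probabilists' Hermite polynomial satisfies
`h_n(x) = E[(x + iZ)^n]` where `Z ~ N(0,1)`; equivalently the real part of
`E[(x + iZ)^n]` is `h_n(x)` and its imaginary part vanishes. -/
theorem stmt_0 (n : ℕ) (x : ℝ) :
    (∫ z : ℝ, ((x : ℂ) + Complex.I * (z : ℂ)) ^ n ∂(gaussianReal 0 1)) =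
      ((Polynomial.aeval x (Polynomial.hermite n) : ℝ) : ℂ) ∧
    (∫ z : ℝ, ((x : ℂ) + Complex.I * (z : ℂ)) ^ n ∂(gaussianReal 0 1)).re =
      (Polynomial.aeval x (Polynomial.hermite n) : ℝ) ∧
    (∫ z : ℝ, ((x : ℂ) + Complex.I * (z : ℂ)) ^ n ∂(gaussianReal 0 1)).im = 0 := by
  have h : (∫ z : ℝ, ((x : ℂ) + Complex.I * (z : ℂ)) ^ n ∂(gaussianReal 0 1)) =
      ((Polynomial.aeval x (Polynomial.hermite n) : ℝ) : ℂ) := by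
    rw [integral_add_I_mul_pow_gaussianReal_eq_aeval_hermite]
    exact aeval_algebraMap_apply ℂ x (hermite n)
  exact ⟨h, by rw [h, ofReal_re], by rw [h, ofReal_im]⟩
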